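/- Fix a natural number n ≥ 3 and a real α with 0 < α < 1/2. For θ = (μ, v₁, v₂) ∈ ℝ × (0,∞) × (0,∞), let P_θ = (gaussianReal μ v₁)^{⊗n} ⊗ (gaussianReal μ v₂)^{⊗n} on (Fin n → ℝ) × (Fin n → ℝ); for a sample x = (x₁, x₂) let X̄ᵢ(x) = (1/n) ∑ⱼ xᵢ(j) and Sᵢ²(x) = (1/(n−1)) ∑ⱼ (xᵢ(j) − X̄ᵢ(x))²; for measurable φ : ℝ × ℝ → [0,1] let δ_φ(x) = X̄₁(x) + (X̄₂(x) − X̄₁(x)) · φ(S₁²(x), S₂²(x)) and R(θ, φ) = ∫ (δ_φ(x) − μ)² dP_θ(x). Let φ_GD(s₁, s₂) = s₁/(s₁ + s₂). For β > 0 let Π_{α,β} be the measure on (0,∞)² with density (v₁, v₂) ↦ ∏_{i=1,2} (β^α / Γ(α)) vᵢ^{−(α+1)} exp(−β/vᵢ) with respect to Lebesgue measure, and let Φ_β(s₁, s₂) = (s₁ + 2β/(n−1)) / (s₁ + s₂ + 4β/(n−1)). Then there exist C' > 0 and β₀ > 0 such that for all β ∈ (0, β₀), the function (v₁, v₂) ↦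 R((0, v₁, v₂), φ_GD) − R((0, v₁, v₂), Φ_β) is Π_{α,β}-integrable and ∫ (R((0, v₁, v₂), φ_GD) − R((0, v₁, v₂), Φ_β)) dΠ_{α,β}(v₁, v₂) ≤ C' · β. -/

import Mathlib

open MeasureTheory ProbabilityTheory

/-- The joint law of two independent samples of size `n` from `N(μ, v₁)` and `N(μ, v₂)`. -/
noncomputable def sampleLaw (n : ℕ) (μ : ℝ) (v₁ v₂ : ℝ) :
    Measure ((Fin n → ℝ) × (Fin n → ℝ)) :=
  (Measure.pi fun _ : Fin n => gaussianReal μ v₁.toNNReal).prod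
    (Measure.pi fun _ : Fin n => gaussianReal μ v₂.toNNReal)

/-- The sample mean of `n` observations. -/
noncomputable def sampleMean (n : ℕ) (x : Fin n → ℝ) : ℝ := (∑ j, x j) / n

/-- The (Bessel-corrected) sample variance of `n` observations. -/
noncomputable def sampleVar (n : ℕ) (x : Fin n → ℝ) : ℝ :=
  (∑ j, (x j - sampleMean n x) ^ 2) / (n - 1)

/-- The estimator `X̄₁ + (X̄₂ - X̄₁) · φ(S₁², S₂²)` of the common mean. -/
noncomputable def estimatorOf (n : ℕ) (φ : ℝ × ℝ → ℝ)
    (x : (Fin n → ℝ) × (Fin n → ℝ)) : ℝ :=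
  sampleMean n x.1 + (sampleMean n x.2 - sampleMean n x.1) *
    φ (sampleVar n x.1, sampleVar n x.2)

/-- The squared-error risk of the estimator determined by `φ` at `θ = (μ, v₁, v₂)`. -/
noncomputable def risk (n : ℕ) (μ v₁ v₂ : ℝ) (φ : ℝ × ℝ → ℝ) : ℝ :=
  ∫ x, (estimatorOf n φ x - μ) ^ 2 ∂(sampleLaw n μ v₁ v₂)

/-- The Graybill–Deal weight function `s₁ / (s₁ + s₂)`. -/
noncomputable def gdWeight (s : ℝ × ℝ) : ℝ := s.1 / (s.1 + s.2)


/-- The inverse-gamma(α, β) density on `(0,∞)`, extended by `0` elsewhere. -/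
noncomputable def invGammaDensity (α β v : ℝ) : ℝ :=
  if 0 < v then β ^ α / Real.Gamma α * v ^ (-(α + 1)) * Real.exp (-β / v) else 0

/-- The product of two inverse-gamma(α, β) distributions, as a measure on `ℝ × ℝ`
with density with respect to two-dimensional Lebesgue measure. -/
noncomputable def invGammaPrior (α β : ℝ) : Measure (ℝ × ℝ) :=
  (volume : Measure (ℝ × ℝ)).withDensity fun v =>
    ENNReal.ofReal (invGammaDensity α β v.1 * invGammaDensity α β v.2)

/-- The Bayes weight function `Φ_β(s₁,s₂) = (s₁ + 2β/(n-1))/(s₁ + s₂ + 4β/(n-1))`. -/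
noncomputable def bayesWeight (n : ℕ) (β : ℝ) (s : ℝ × ℝ) : ℝ :=
  (s.1 + 2 * β / (n - 1)) / (s.1 + s.2 + 4 * β / (n - 1))

section helpers
open Set

lemma aux_base (q : ℝ) (hq1 : q < 1) :
    ∫⁻ t in Ioo (-1:ℝ) 1, ENNReal.ofReal |t| ^ (-q) < ⊤ := by
  have hpos : ∫⁻ t in Ioc (0:ℝ) 1, ENNReal.ofReal |t| ^ (-q) < ⊤ := by
    have h := (intervalIntegral.intervalIntegrable_rpow' (a := 0) (b := 1) (r := -q) (by linarith)).1
    have h2 := h.2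
    rw [HasFiniteIntegral] at h2
    refine lt_of_le_of_lt (le_of_eq ?_) h2
    refine setLIntegral_congr_fun measurableSet_Ioc ?_
    intro t ht
    simp only
    rw [abs_of_pos ht.1, ENNReal.ofReal_rpow_of_pos ht.1, Real.enorm_of_nonneg]
    exact Real.rpow_nonneg ht.1.le _
  have hneg : ∫⁻ t in Ico (-1:ℝ) 0, ENNReal.ofReal |t| ^ (-q) < ⊤ := by
    have h := (Measure.measurePreserving_neg (volume : Measure ℝ)).setLIntegral_comp_preimage_emb
      (MeasurableEquiv.neg ℝ).measurableEmbedding (fun t => ENNReal.ofReal |t| ^ (-q)) (Ioc (0:ℝ) 1)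
    have e : (Neg.neg ⁻¹' (Ioc (0:ℝ) 1)) = Ico (-1:ℝ) 0 := by
      ext t; simp only [mem_preimage, mem_Ioc, mem_Ico]; constructor <;> intro ⟨a, b⟩ <;> constructor <;> linarith
    rw [e] at h
    simp only [abs_neg] at h
    rw [h]; exact hpos
  have hz : ∫⁻ t in ({0} : Set ℝ), ENNReal.ofReal |t| ^ (-q) = 0 :=
    setLIntegral_measure_zero _ _ (by simp)
  have hsub : Ioo (-1:ℝ) 1 ⊆ (Ico (-1:ℝ) 0 ∪ {0}) ∪ Ioc (0:ℝ) 1 := by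
    intro t ht
    rcases lt_trichotomy t 0 with h | h | h
    · exact Or.inl (Or.inl ⟨ht.1.le, h⟩)
    · exact Or.inl (Or.inr h)
    · exact Or.inr ⟨h, ht.2.le⟩
  calc _ ≤ _ := lintegral_mono_set hsub
    _ ≤ _ := lintegral_union_le _ _ _
    _ ≤ ((∫⁻ t in Ico (-1:ℝ) 0, ENNReal.ofReal |t| ^ (-q)) + ∫⁻ t in ({0} : Set ℝ), ENNReal.ofReal |t| ^ (-q)) + ∫⁻ t in Ioc (0:ℝ) 1, ENNReal.ofReal |t| ^ (-q) :=
        add_le_add_left (lintegral_union_le _ _ _) _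
    _ < ⊤ := by rw [hz]; simp [hpos, hneg]

lemma gauss_le : gaussianReal 0 1 ≤ (volume : Measure ℝ) := by
  rw [gaussianReal_of_var_ne_zero _ one_ne_zero]
  calc _ ≤ (volume : Measure ℝ).withDensity 1 := by
        refine withDensity_mono (Filter.Eventually.of_forall fun x => ?_)
        simp only [gaussianPDF, gaussianPDFReal, Pi.one_apply]
        rw [ENNReal.ofReal_le_one]
        have h1 : (√(2 * Real.pi * ((1:NNReal):ℝ)))⁻¹ ≤ 1 := by
          apply inv_le_one_of_one_le₀
          rw [Real.one_le_sqrt]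
          have := Real.pi_gt_three
          simp; linarith
        have h2 : Real.exp (-(x - 0) ^ 2 / (2 * ((1:NNReal):ℝ))) ≤ 1 := by
          rw [Real.exp_le_one_iff]
          simp; nlinarith [sq_nonneg x]
        exact mul_le_one₀ h1 (Real.exp_nonneg _) h2
    _ = _ := by simp

lemma aux_oned (q : ℝ) (hq0 : 0 < q) (hq1 : q < 1) : ∃ K : ENNReal, K < ⊤ ∧ ∀ a : ℝ,
    ∫⁻ t, ENNReal.ofReal |t - a| ^ (-q) ∂(gaussianReal 0 1) ≤ K := by
  refine ⟨1 + ∫⁻ t in Ioo (-1:ℝ) 1, ENNReal.ofReal |t| ^ (-q), by simp [aux_base q hq1], fun a => ?_⟩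
  set f : ℝ → ENNReal := (Ioo (-1:ℝ) 1).indicator (fun t => ENNReal.ofReal |t| ^ (-q)) with hf
  have hb : ∀ t : ℝ, ENNReal.ofReal |t - a| ^ (-q) ≤ 1 + f (t - a) := by
    intro t
    by_cases h : t - a ∈ Ioo (-1:ℝ) 1
    · rw [hf, indicator_of_mem h]; exact le_add_self
    · refine le_trans ?_ le_self_add
      rw [← abs_lt.trans (by rfl : _ ↔ t - a ∈ Ioo (-1:ℝ) 1), not_lt] at h
      rw [ENNReal.rpow_neg, ENNReal.inv_le_one]
      exact ENNReal.one_le_rpow (by simpa using ENNReal.ofReal_le_ofReal h) hq0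
  calc _ ≤ ∫⁻ t, (1 + f (t - a)) ∂(gaussianReal 0 1) := lintegral_mono hb
    _ = 1 + ∫⁻ t, f (t - a) ∂(gaussianReal 0 1) := by
        rw [lintegral_add_left measurable_const]; simp
    _ ≤ 1 + ∫⁻ t, f (t - a) := by gcongr; exact gauss_le
    _ = 1 + ∫⁻ t, f t := by rw [lintegral_sub_right_eq_self f a]
    _ = _ := by rw [hf, lintegral_indicator measurableSet_Ioo]

noncomputable abbrev stdPi (n : ℕ) : Measure (Fin n → ℝ) := Measure.pi fun _ : Fin n => gaussianReal 0 1

lemma lint_cons (n : ℕ) (f : (Fin (n+1) → ℝ) → ENNReal) (hf : Measurable f) :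
    ∫⁻ x, f x ∂(stdPi (n+1)) =
      ∫⁻ y, ∫⁻ t, f (Fin.cons t y) ∂(gaussianReal 0 1) ∂(stdPi n) := by
  have h := measurePreserving_piFinSuccAbove (fun _ : Fin (n+1) => gaussianReal 0 1) 0
  have h2 := (h.symm (MeasurableEquiv.piFinSuccAbove (fun _ : Fin (n+1) => ℝ) 0)).lintegral_comp hf
  rw [← h2, lintegral_prod_symm _ (by
    exact (hf.comp (MeasurableEquiv.measurable _)).aemeasurable)]
  refine lintegral_congr fun y => lintegral_congr fun t => ?_
  congr 1
  funext j
  refine Fin.cases ?_ (fun i => ?_) j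
  · simp [MeasurableEquiv.piFinSuccAbove, Fin.insertNthEquiv]
  · simp [MeasurableEquiv.piFinSuccAbove, Fin.insertNthEquiv]

lemma lint_prod (k : ℕ) (q : ℝ) (hq0 : 0 < q) (hq1 : q < 1) :
    ∫⁻ x : Fin (k+3) → ℝ, ENNReal.ofReal |x 0 - x 1| ^ (-q) * ENNReal.ofReal |x 1 - x 2| ^ (-q)
      ∂(stdPi (k+3)) < ⊤ := by
  obtain ⟨K, hK, hb⟩ := aux_oned q hq0 hq1
  have m1 : Measurable fun x : Fin (k+3) → ℝ =>
      ENNReal.ofReal |x 0 - x 1| ^ (-q) * ENNReal.ofReal |x 1 - x 2| ^ (-q) := by fun_prop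
  have m2 : Measurable fun x : Fin (k+2) → ℝ => ENNReal.ofReal |x 0 - x 1| ^ (-q) := by fun_prop
  rw [lint_cons _ _ m1]
  have e2 : (2 : Fin (k+3)) = Fin.succ 1 := by ext; simp
  have e1 : (1 : Fin (k+3)) = Fin.succ 0 := by ext; simp
  calc _ ≤ ∫⁻ y : Fin (k+2) → ℝ, K * ENNReal.ofReal |y 0 - y 1| ^ (-q) ∂(stdPi (k+2)) := by
        refine lintegral_mono fun y => ?_
        simp only [e2, e1, Fin.cons_succ, Fin.cons_zero]
        rw [lintegral_mul_const _ (by fun_prop)]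
        gcongr
        exact hb _
    _ = K * ∫⁻ y : Fin (k+2) → ℝ, ENNReal.ofReal |y 0 - y 1| ^ (-q) ∂(stdPi (k+2)) :=
        lintegral_const_mul _ m2
    _ ≤ K * K := by
        gcongr
        rw [lint_cons _ _ m2]
        have e1 : (1 : Fin (k+2)) = Fin.succ 0 := by ext; simp
        calc _ ≤ ∫⁻ y : Fin (k+1) → ℝ, K ∂(stdPi (k+1)) := by
              refine lintegral_mono fun y => ?_
              simp only [e1, Fin.cons_succ, Fin.cons_zero]
              exact hb _
          _ = K := by simp
    _ < ⊤ := ENNReal.mul_lt_top hK hK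

lemma meas_mean (n : ℕ) : Measurable (sampleMean n) := by unfold sampleMean; fun_prop
lemma meas_var (n : ℕ) : Measurable (sampleVar n) := by
  have := meas_mean n
  unfold sampleVar; fun_prop

lemma var_nonneg (n : ℕ) (hn : 3 ≤ n) (x : Fin n → ℝ) : 0 ≤ sampleVar n x := by
  have : (3:ℝ) ≤ n := by exact_mod_cast hn
  unfold sampleVar
  exact div_nonneg (Finset.sum_nonneg fun _ _ => sq_nonneg _) (by linarith)

lemma var_ge (n : ℕ) (hn : 3 ≤ n) (x : Fin n → ℝ) (i j : Fin n) (hij : i ≠ j) :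
    (x i - x j)^2 / (2 * (n - 1)) ≤ sampleVar n x := by
  have h3 : (3:ℝ) ≤ n := by exact_mod_cast hn
  unfold sampleVar
  rw [div_mul_eq_div_div]
  gcongr
  · linarith
  · set m := sampleMean n x
    calc (x i - x j)^2 / 2 ≤ (x i - m)^2 + (x j - m)^2 := by nlinarith [sq_nonneg (x i - m + (x j - m))]
      _ = ∑ l ∈ ({i, j} : Finset (Fin n)), (x l - m)^2 := by rw [Finset.sum_pair hij]
      _ ≤ _ := Finset.sum_le_sum_of_subset_of_nonneg (Finset.subset_univ _) fun _ _ _ => sq_nonneg _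

lemma lint_var (n : ℕ) (hn : 3 ≤ n) (q : ℝ) (hq0 : 0 < q) (hq1 : q < 1) :
    ∫⁻ x, ENNReal.ofReal (sampleVar n x) ^ (-q) ∂(stdPi n) < ⊤ := by
  obtain ⟨k, rfl⟩ : ∃ k, n = k + 3 := ⟨n - 3, by omega⟩
  set c : ℝ := 1 / (2 * (((k+3:ℕ):ℝ) - 1)) with hc
  have hcpos : 0 < c := by
    rw [hc]; push_cast
    have : (0:ℝ) ≤ k := Nat.cast_nonneg k
    apply div_pos one_pos; linarith
  have key : ∀ x : Fin (k+3) → ℝ, ENNReal.ofReal (sampleVar (k+3) x) ^ (-q) ≤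
      ENNReal.ofReal c ^ (-q) * (ENNReal.ofReal |x 0 - x 1| ^ (-q) * ENNReal.ofReal |x 1 - x 2| ^ (-q)) := by
    intro x
    have h1 := var_ge (k+3) hn x 0 1 (by simp)
    have h2 := var_ge (k+3) hn x 1 2 (by
      rw [Ne, Fin.ext_iff]; simp only [Fin.val_one, Fin.val_two]; norm_num)
    rw [div_eq_mul_one_div, ← hc, ← sq_abs] at h1 h2
    have h : c * (|x 0 - x 1| * |x 1 - x 2|) ≤ sampleVar (k+3) x := by
      nlinarith [sq_nonneg (|x 0 - x 1| - |x 1 - x 2|)]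
    rw [← ENNReal.mul_rpow_of_ne_top (by simp) (by simp), ← ENNReal.mul_rpow_of_ne_top (by simp) (by finiteness),
      ← ENNReal.ofReal_mul (abs_nonneg _), ← ENNReal.ofReal_mul hcpos.le, ENNReal.rpow_neg, ENNReal.rpow_neg,
      ENNReal.inv_le_inv]
    gcongr
  calc _ ≤ _ := lintegral_mono key
    _ = ENNReal.ofReal c ^ (-q) * _ := lintegral_const_mul _ (by fun_prop)
    _ < ⊤ := by
        refine ENNReal.mul_lt_top ?_ (lint_prod k q hq0 hq1)
        rw [ENNReal.ofReal_rpow_of_pos hcpos]; simp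

lemma var_pos_ae (n : ℕ) (hn : 3 ≤ n) : ∀ᵐ x ∂(stdPi n), 0 < sampleVar n x := by
  have := ae_lt_top (((meas_var n).ennreal_ofReal).pow_const (-(1/2:ℝ))) (lint_var n hn (1/2) (by norm_num) (by norm_num)).ne
  filter_upwards [this] with x hx
  rcases (var_nonneg n hn x).eq_or_lt with h | h
  · rw [← h] at hx; simp at hx
  · exact h

lemma int_var (n : ℕ) (hn : 3 ≤ n) (q : ℝ) (hq0 : 0 < q) (hq1 : q < 1) :
    Integrable (fun x => sampleVar n x ^ (-q)) (stdPi n) := by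
  refine ⟨((meas_var n).pow_const _).aestronglyMeasurable, ?_⟩
  refine lt_of_le_of_lt (le_of_eq ?_) (lint_var n hn q hq0 hq1)
  refine lintegral_congr_ae ?_
  filter_upwards [var_pos_ae n hn] with x hx
  rw [ENNReal.ofReal_rpow_of_pos hx, Real.enorm_of_nonneg (Real.rpow_nonneg hx.le _)]

lemma memLp_mean (n : ℕ) (p : ENNReal) (hp : p ≠ ⊤) : MemLp (sampleMean n) p (stdPi n) := by
  have h : MemLp (fun x : Fin n → ℝ => ∑ j, x j) p (stdPi n) := by
    refine memLp_finsetSum _ fun j _ => ?_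
    exact (memLp_id_gaussianReal' p hp).comp_measurePreserving
      (measurePreserving_eval (fun _ : Fin n => gaussianReal 0 1) j)
  unfold sampleMean
  simpa [div_eq_inv_mul] using h.const_mul (n:ℝ)⁻¹

lemma int_mean_sq (n : ℕ) : Integrable (fun x => sampleMean n x ^ 2) (stdPi n) :=
  (memLp_mean n 2 (by simp)).integrable_sq

lemma int_G (n : ℕ) (hn : 3 ≤ n) (ε : ℝ) (h0 : 0 < ε) (h1 : ε < 1) :
    Integrable (fun x => sampleMean n x ^ 2 * sampleVar n x ^ (-(1 - ε))) (stdPi n) := by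
  set r : ℝ := (1 - ε/2) / (1 - ε) with hr
  have hr1 : 1 < r := by rw [hr, lt_div_iff₀ (by linarith)]; linarith
  set p := r.conjExponent with hp
  have hc : p.HolderConjugate r := (Real.HolderConjugate.conjExponent hr1).symm
  have hp0 : 0 < p := hc.pos
  have i1 : Integrable (fun x => ‖sampleMean n x‖ ^ (2 * p)) (stdPi n) := by
    have := (memLp_mean n (ENNReal.ofReal (2*p)) ENNReal.ofReal_ne_top).integrable_norm_rpow
      (by rw [Ne, ENNReal.ofReal_eq_zero]; linarith) ENNReal.ofReal_ne_top
    rwa [ENNReal.toReal_ofReal (by linarith)] at this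
  have i2 := int_var n hn (1 - ε/2) (by linarith) (by linarith)
  refine ((i1.div_const p).add (i2.div_const r)).mono'
    (((meas_mean n).pow_const 2).mul ((meas_var n).pow_const _)).aestronglyMeasurable ?_
  refine Filter.Eventually.of_forall fun x => ?_
  have hv := var_nonneg n hn x
  rw [Real.norm_of_nonneg (mul_nonneg (sq_nonneg _) (Real.rpow_nonneg hv _))]
  have := Real.young_inequality_of_nonneg (sq_nonneg (sampleMean n x)) (Real.rpow_nonneg hv (-(1-ε))) hc
  refine this.trans (le_of_eq ?_)
  simp only [Pi.add_apply]
  congr 2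
  · rw [Real.rpow_mul (norm_nonneg _)]; simp
  · rw [← Real.rpow_mul hv]; congr 1; rw [hr]; have : (1-ε) ≠ 0 := by linarith
    field_simp

lemma dens_mul (α β e v : ℝ) (hα : 0 < α) : 
    invGammaDensity α β v * v ^ e = (Ioi (0:ℝ)).indicator (fun v => 
      β ^ α / Real.Gamma α * ((|(-1:ℝ)| * v ^ ((-1:ℝ) - 1)) • 
        ((fun t : ℝ => t ^ ((α - e) - 1) * Real.exp (-(β * t))) (v ^ (-1:ℝ))))) v := by
  unfold invGammaDensity
  by_cases h : 0 < v
  · rw [if_pos h, indicator_of_mem (by exact h)]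
    simp only [smul_eq_mul, abs_neg, abs_one, one_mul]
    rw [← Real.rpow_mul h.le, Real.rpow_neg_one, mul_right_comm, mul_assoc (β ^ α / Real.Gamma α),
      ← Real.rpow_add h, ← mul_assoc (v ^ _), ← Real.rpow_add h, mul_assoc]
    congr 3
    · ring
    · rw [div_eq_mul_inv]; ring
  · rw [if_neg h, indicator_of_notMem (by exact h)]; simp

lemma int_base (a β : ℝ) (ha : 0 < a) (hβ : 0 < β) : 
    IntegrableOn (fun t : ℝ => t ^ (a - 1) * Real.exp (-(β * t))) (Ioi 0) := by
  have := integrableOn_rpow_mul_exp_neg_mul_rpow (p := 1) (s := a - 1) (b := β) (by linarith) one_pos hβ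
  simpa using this

lemma dens_int (α β e : ℝ) (hα : 0 < α) (he : e < α) (hβ : 0 < β) :
    Integrable (fun v => invGammaDensity α β v * v ^ e) := by
  have h := (integrableOn_Ioi_comp_rpow_iff (fun t : ℝ => t ^ ((α - e) - 1) * Real.exp (-(β * t)))
    (p := -1) (by norm_num)).2 (int_base (α - e) β (by linarith) hβ)
  simp_rw [dens_mul α β e _ hα]
  exact (integrable_indicator_iff measurableSet_Ioi).2 (h.const_mul _)

lemma dens_integral (α β e : ℝ) (hα : 0 < α) (he : e < α) (hβ : 0 < β) :
    ∫ v, invGammaDensity α β v * v ^ e = β ^ e * (Real.Gamma (α - e) / Real.Gamma α) := by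
  simp_rw [dens_mul α β e _ hα]
  rw [integral_indicator measurableSet_Ioi, integral_const_mul,
    integral_comp_rpow_Ioi (fun t : ℝ => t ^ ((α - e) - 1) * Real.exp (-(β * t))) (by norm_num),
    Real.integral_rpow_mul_exp_neg_mul_Ioi (by linarith) hβ, one_div, Real.inv_rpow hβ.le, 
    ← Real.rpow_neg hβ.le]
  have : β ^ e = β ^ α * β ^ (-(α - e)) := by rw [← Real.rpow_add hβ]; congr 1; ring
  rw [this]; ring

lemma dens_nonneg (α β v : ℝ) (hα : 0 < α) (hβ : 0 < β) : 0 ≤ invGammaDensity α β v := by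
  unfold invGammaDensity
  have := Real.Gamma_pos_of_pos hα
  split_ifs with h <;> positivity

lemma dens_meas (α β : ℝ) : Measurable (invGammaDensity α β) := by
  unfold invGammaDensity
  refine Measurable.ite measurableSet_Ioi (by fun_prop) measurable_const

/-- moments under the prior -/
lemma prior_mom (α β e : ℝ) (hα : 0 < α) (he : e < α) (he' : -e < α) (hβ : 0 < β) :
    Integrable (fun v : ℝ × ℝ => v.1 ^ e * v.2 ^ (-e)) (invGammaPrior α β) ∧
    ∫ v : ℝ × ℝ, v.1 ^ e * v.2 ^ (-e) ∂(invGammaPrior α β) =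
      (Real.Gamma (α - e) / Real.Gamma α) * (Real.Gamma (α + e) / Real.Gamma α) := by
  have hm : Measurable fun v : ℝ × ℝ => ENNReal.ofReal (invGammaDensity α β v.1 * invGammaDensity α β v.2) := by
    have := dens_meas α β
    fun_prop
  have e1 : ∀ v : ℝ × ℝ, (ENNReal.ofReal (invGammaDensity α β v.1 * invGammaDensity α β v.2)).toReal •
      (v.1 ^ e * v.2 ^ (-e)) = (invGammaDensity α β v.1 * v.1 ^ e) * (invGammaDensity α β v.2 * v.2 ^ (-e)) := by
    intro v
    rw [ENNReal.toReal_ofReal (mul_nonneg (dens_nonneg _ _ _ hα hβ) (dens_nonneg _ _ _ hα hβ)), smul_eq_mul]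
    ring
  unfold invGammaPrior
  constructor
  · rw [integrable_withDensity_iff_integrable_smul' hm (by simp)]
    simp_rw [e1]
    exact (dens_int α β e hα he hβ).mul_prod (dens_int α β (-e) hα he' hβ)
  · rw [integral_withDensity_eq_integral_toReal_smul hm (by simp)]
    simp_rw [e1]
    rw [Measure.volume_eq_prod, integral_prod_mul (fun x => invGammaDensity α β x * x ^ e) (fun x => invGammaDensity α β x * x ^ (-e)),
      dens_integral α β e hα he hβ, dens_integral α β (-e) hα he' hβ]
    have : β ^ e * β ^ (-e) = 1 := by rw [← Real.rpow_add hβ]; simp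
    rw [sub_neg_eq_add]
    linear_combination (Real.Gamma (α - e) / Real.Gamma α) * (Real.Gamma (α + e) / Real.Gamma α) * this

lemma prior_pos (α β : ℝ) : ∀ᵐ v ∂(invGammaPrior α β), 0 < v.1 ∧ 0 < v.2 := by
  have hm : Measurable fun v : ℝ × ℝ => ENNReal.ofReal (invGammaDensity α β v.1 * invGammaDensity α β v.2) := by
    have := dens_meas α β
    fun_prop
  unfold invGammaPrior
  rw [ae_withDensity_iff hm]
  refine Filter.Eventually.of_forall fun v hv => ?_
  constructor <;> by_contra h <;> apply hv <;> simp [invGammaDensity, h]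


lemma stdPi_scale (n : ℕ) (v : ℝ) : (stdPi n).map (fun x j => √v * x j) =
    Measure.pi fun _ : Fin n => gaussianReal 0 v.toNNReal := by
  have e : (gaussianReal 0 1).map (fun x => √v * x) = gaussianReal 0 v.toNNReal := by
    rw [gaussianReal_map_const_mul]
    congr 1
    · simp
    · ext
      simp only [mul_one, NNReal.coe_mk, Real.coe_toNNReal']
      rcases le_total 0 v with h | h
      · rw [Real.sq_sqrt h, max_eq_left h]
      · rw [Real.sqrt_eq_zero_of_nonpos h, max_eq_right h]; simp
  unfold stdPi
  have : SigmaFinite ((gaussianReal 0 1).map (fun x => √v * x)) := by rw [e]; infer_instance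
  rw [Measure.pi_map_pi (f := fun _ x => √v * x) (fun _ => by fun_prop)]
  simp_rw [e]

noncomputable def scl {n : ℕ} (v : ℝ × ℝ) (x : (Fin n → ℝ) × (Fin n → ℝ)) : (Fin n → ℝ) × (Fin n → ℝ) :=
  (fun j => √v.1 * x.1 j, fun j => √v.2 * x.2 j)

lemma meas_est (n : ℕ) (φ : ℝ × ℝ → ℝ) (hφ : Measurable φ) : Measurable (estimatorOf n φ) := by
  have := meas_mean n
  have := meas_var n
  unfold estimatorOf; fun_prop

lemma meas_scl (n : ℕ) : Measurable (Function.uncurry (scl (n := n))) := by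
  unfold scl Function.uncurry
  fun_prop

lemma risk_eq (n : ℕ) (v : ℝ × ℝ) (φ : ℝ × ℝ → ℝ) (hφ : Measurable φ) :
    risk n 0 v.1 v.2 φ = ∫ x, (estimatorOf n φ (scl v x)) ^ 2 ∂((stdPi n).prod (stdPi n)) := by
  unfold risk sampleLaw
  rw [← stdPi_scale, ← stdPi_scale, Measure.map_prod_map _ _ (by fun_prop) (by fun_prop), integral_map]
  · simp only [sub_zero]; rfl
  · fun_prop
  · have := meas_est n φ hφ
    exact Measurable.aestronglyMeasurable (by fun_prop)

lemma meas_gd : Measurable gdWeight := by unfold gdWeight; fun_prop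
lemma meas_bayes (n : ℕ) (β : ℝ) : Measurable (bayesWeight n β) := by unfold bayesWeight; fun_prop

lemma mean_scale (n : ℕ) (c : ℝ) (x : Fin n → ℝ) : sampleMean n (fun j => c * x j) = c * sampleMean n x := by
  unfold sampleMean; rw [← Finset.mul_sum]; ring

lemma var_scale (n : ℕ) (c : ℝ) (x : Fin n → ℝ) : sampleVar n (fun j => c * x j) = c ^ 2 * sampleVar n x := by
  unfold sampleVar; rw [mean_scale, mul_div_assoc', Finset.mul_sum]; congr 2; ext j; ring

lemma est_sq_le (m1 m2 f : ℝ) (h0 : 0 ≤ f) (h1 : f ≤ 1) : 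
    (m1 + (m2 - m1) * f) ^ 2 ≤ m1 ^ 2 + m2 ^ 2 := by
  nlinarith [mul_nonneg (mul_nonneg h0 (sub_nonneg.2 h1)) (sq_nonneg (m1 - m2)), mul_nonneg h0 (sq_nonneg m1),
    mul_nonneg (sub_nonneg.2 h1) (sq_nonneg m2)]

lemma gd_mem (s : ℝ × ℝ) (h1 : 0 ≤ s.1) (h2 : 0 ≤ s.2) : 0 ≤ gdWeight s ∧ gdWeight s ≤ 1 := by
  unfold gdWeight
  exact ⟨by positivity, div_le_one_of_le₀ (by linarith) (by linarith)⟩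

lemma bayes_mem (n : ℕ) (hn : 3 ≤ n) (β : ℝ) (hβ : 0 < β) (s : ℝ × ℝ) (h1 : 0 ≤ s.1) (h2 : 0 ≤ s.2) : 
    0 ≤ bayesWeight n β s ∧ bayesWeight n β s ≤ 1 := by
  unfold bayesWeight
  have h3 : (3:ℝ) ≤ n := by exact_mod_cast hn
  have hb : 0 < 2 * β / ((n:ℝ) - 1) := div_pos (by linarith) (by linarith)
  have e : 4 * β / ((n:ℝ) - 1) = 2 * (2 * β / ((n:ℝ) - 1)) := by ring
  rw [e]
  exact ⟨div_nonneg (by linarith) (by linarith), div_le_one_of_le₀ (by linarith) (by linarith)⟩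

lemma int_est (n : ℕ) (hn : 3 ≤ n) (v : ℝ × ℝ) (φ : ℝ × ℝ → ℝ) (hφ : Measurable φ)
    (h : ∀ s : ℝ × ℝ, 0 ≤ s.1 → 0 ≤ s.2 → 0 ≤ φ s ∧ φ s ≤ 1) :
    Integrable (fun x => (estimatorOf n φ (scl v x)) ^ 2) ((stdPi n).prod (stdPi n)) := by
  have i1 := ((int_mean_sq n).comp_fst (stdPi n)).const_mul (√v.1 ^ 2)
  have i2 := ((int_mean_sq n).comp_snd (stdPi n)).const_mul (√v.2 ^ 2)
  refine (i1.add i2).mono' ?_ (Filter.Eventually.of_forall fun x => ?_)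
  · have m := meas_est n φ hφ
    have m2 := meas_scl n
    exact ((m.comp (m2.comp measurable_prodMk_left)).pow_const 2).aestronglyMeasurable
  · rw [Real.norm_of_nonneg (sq_nonneg _)]
    obtain ⟨a, b⟩ := h (sampleVar n (scl v x).1, sampleVar n (scl v x).2) (var_nonneg n hn _) (var_nonneg n hn _)
    refine (est_sq_le _ _ _ a b).trans (le_of_eq ?_)
    simp only [scl, mean_scale, Pi.add_apply]; ring

lemma pt_bound (n : ℕ) (hn : 3 ≤ n) (β m1 m2 s1 s2 : ℝ) (hβ : 0 < β) (h1 : 0 < s1) (h2 : 0 < s2) :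
    |(m1 + (m2 - m1) * gdWeight (s1, s2)) ^ 2 - (m1 + (m2 - m1) * bayesWeight n β (s1, s2)) ^ 2| ≤
      4 * β * (m1 ^ 2 / (s1 + s2) + m2 ^ 2 / (s1 + s2)) := by
  have h3 : (3:ℝ) ≤ n := by exact_mod_cast hn
  have hd : |gdWeight (s1, s2) - bayesWeight n β (s1, s2)| ≤ β / (s1 + s2) := by
    unfold gdWeight bayesWeight
    have hb : 0 < 2 * β / ((n:ℝ) - 1) := div_pos (by linarith) (by linarith)
    have hb2 : 2 * β / ((n:ℝ) - 1) ≤ β := by rw [div_le_iff₀ (by linarith)]; nlinarith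
    have e : 4 * β / ((n:ℝ) - 1) = 2 * (2 * β / ((n:ℝ) - 1)) := by ring
    rw [e]
    set b := 2 * β / ((n:ℝ) - 1)
    simp only
    have e2 : s1 / (s1 + s2) - (s1 + b) / (s1 + s2 + 2 * b) = 
      (b / (s1 + s2)) * ((s1 - s2) / (s1 + s2 + 2 * b)) := by field_simp; ring
    rw [e2, abs_mul, abs_of_pos (by positivity)]
    have : |(s1 - s2) / (s1 + s2 + 2 * b)| ≤ 1 := by
      rw [abs_div, abs_of_pos (a := s1 + s2 + 2 * b) (by positivity)]
      apply div_le_one_of_le₀ _ (by positivity)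
      rw [abs_le]; constructor <;> linarith
    calc _ ≤ (b / (s1 + s2)) * 1 := by gcongr
      _ ≤ _ := by rw [mul_one]; gcongr
  obtain ⟨a0, a1⟩ := gd_mem (s1, s2) h1.le h2.le
  obtain ⟨b0, b1⟩ := bayes_mem n hn β hβ (s1, s2) h1.le h2.le
  set f := gdWeight (s1, s2)
  set g := bayesWeight n β (s1, s2)
  have e : (m1 + (m2 - m1) * f) ^ 2 - (m1 + (m2 - m1) * g) ^ 2 =
    (f - g) * ((m2 - m1) * (m1 * ((1 - f) + (1 - g)) + m2 * (f + g))) := by ring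
  have hq : |(m2 - m1) * (m1 * ((1 - f) + (1 - g)) + m2 * (f + g))| ≤ 4 * (m1 ^ 2 + m2 ^ 2) := by
    have t1 : |m2 - m1| ≤ |m1| + |m2| := by rw [add_comm]; exact abs_sub _ _
    have t2 : |m1 * ((1 - f) + (1 - g)) + m2 * (f + g)| ≤ 2 * (|m1| + |m2|) := by
      refine (abs_add_le _ _).trans ?_
      rw [abs_mul, abs_mul, abs_of_nonneg (by linarith : 0 ≤ 1 - f + (1 - g)), abs_of_nonneg (by linarith : 0 ≤ f + g)]
      nlinarith [abs_nonneg m1, abs_nonneg m2]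
    rw [abs_mul]
    calc _ ≤ (|m1| + |m2|) * (2 * (|m1| + |m2|)) := by gcongr
      _ ≤ _ := by nlinarith [sq_nonneg (|m1| - |m2|), sq_abs m1, sq_abs m2]
  rw [e, abs_mul]
  calc _ ≤ (β / (s1 + s2)) * (4 * (m1 ^ 2 + m2 ^ 2)) := by gcongr
    _ = _ := by ring

lemma gm_bound (ε s1 s2 : ℝ) (h0 : 0 < ε) (h1 : ε < 1) (p1 : 0 < s1) (p2 : 0 < s2) :
    1 / (s1 + s2) ≤ s1 ^ (-(1 - ε)) * s2 ^ (-ε) := by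
  rw [Real.rpow_neg p1.le, Real.rpow_neg p2.le, ← mul_inv, one_div]
  apply inv_anti₀ (by positivity)
  calc s1 ^ (1 - ε) * s2 ^ ε ≤ (s1 + s2) ^ (1 - ε) * (s1 + s2) ^ ε := by
        gcongr <;> linarith
    _ = s1 + s2 := by rw [← Real.rpow_add (by positivity)]; simp

lemma term_bound (ε v1 v2 M S1 S2 : ℝ) (h0 : 0 < ε) (h1 : ε < 1) (p1 : 0 < v1) (p2 : 0 < v2) 
    (q1 : 0 < S1) (q2 : 0 < S2) :
    (√v1 * M) ^ 2 / (√v1 ^ 2 * S1 + √v2 ^ 2 * S2) ≤ 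
      v1 ^ ε * v2 ^ (-ε) * ((M ^ 2 * S1 ^ (-(1 - ε))) * S2 ^ (-ε)) := by
  rw [mul_pow, Real.sq_sqrt p1.le, Real.sq_sqrt p2.le, div_eq_mul_one_div]
  have := gm_bound ε (v1 * S1) (v2 * S2) h0 h1 (by positivity) (by positivity)
  rw [Real.mul_rpow p1.le q1.le, Real.mul_rpow p2.le q2.le] at this
  calc _ ≤ v1 * M ^ 2 * (v1 ^ (-(1 - ε)) * S1 ^ (-(1 - ε)) * (v2 ^ (-ε) * S2 ^ (-ε))) :=
        mul_le_mul_of_nonneg_left this (by positivity)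
    _ = (v1 ^ (1:ℝ) * v1 ^ (-(1 - ε))) * v2 ^ (-ε) * ((M ^ 2 * S1 ^ (-(1 - ε))) * S2 ^ (-ε)) := by
      rw [Real.rpow_one]; ring
    _ = _ := by rw [← Real.rpow_add p1]; ring_nf

lemma risk_diff_bound (n : ℕ) (hn : 3 ≤ n) (ε : ℝ) (h0 : 0 < ε) (h1 : ε < 1) :
    ∃ K : ℝ, 0 ≤ K ∧ ∀ β : ℝ, 0 < β → ∀ v : ℝ × ℝ, 0 < v.1 → 0 < v.2 →
      |risk n 0 v.1 v.2 gdWeight - risk n 0 v.1 v.2 (bayesWeight n β)| ≤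
        K * β * (v.1 ^ ε * v.2 ^ (-ε) + v.1 ^ (-ε) * v.2 ^ ε) := by
  set G : (Fin n → ℝ) → ℝ := fun x => sampleMean n x ^ 2 * sampleVar n x ^ (-(1 - ε)) with hG
  set H : (Fin n → ℝ) → ℝ := fun x => sampleVar n x ^ (-ε) with hH
  have iG : Integrable G (stdPi n) := int_G n hn ε h0 h1
  have iH : Integrable H (stdPi n) := int_var n hn ε h0 h1
  have nG : ∀ x, 0 ≤ G x := fun x => mul_nonneg (sq_nonneg _) (Real.rpow_nonneg (var_nonneg n hn x) _)
  have nH : ∀ x, 0 ≤ H x := fun x => Real.rpow_nonneg (var_nonneg n hn x) _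
  refine ⟨4 * ((∫ x, G x ∂(stdPi n)) * (∫ x, H x ∂(stdPi n))), 
    mul_nonneg (by norm_num) (mul_nonneg (integral_nonneg nG) (integral_nonneg nH)), ?_⟩
  intro β hβ v hv1 hv2
  rw [risk_eq n v _ meas_gd, risk_eq n v _ (meas_bayes n β),
    ← integral_sub (int_est n hn v _ meas_gd gd_mem) (int_est n hn v _ (meas_bayes n β) (bayes_mem n hn β hβ))]
  refine (abs_integral_le_integral_abs).trans ?_
  have iB : Integrable (fun x : (Fin n → ℝ) × (Fin n → ℝ) => 4 * β * (v.1 ^ ε * v.2 ^ (-ε) * (G x.1 * H x.2) +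
      v.1 ^ (-ε) * v.2 ^ ε * (H x.1 * G x.2))) ((stdPi n).prod (stdPi n)) :=
    (((iG.mul_prod iH).const_mul _).add ((iH.mul_prod iG).const_mul _)).const_mul _
  have hpos := var_pos_ae n hn
  have hp1 : ∀ᵐ x ∂((stdPi n).prod (stdPi n)), 0 < sampleVar n x.1 := 
    Measure.quasiMeasurePreserving_fst.ae hpos
  have hp2 : ∀ᵐ x ∂((stdPi n).prod (stdPi n)), 0 < sampleVar n x.2 := 
    Measure.quasiMeasurePreserving_snd.ae hpos
  calc _ ≤ ∫ x : (Fin n → ℝ) × (Fin n → ℝ), 4 * β * (v.1 ^ ε * v.2 ^ (-ε) * (G x.1 * H x.2) +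
      v.1 ^ (-ε) * v.2 ^ ε * (H x.1 * G x.2)) ∂((stdPi n).prod (stdPi n)) := by
        refine integral_mono_of_nonneg (Filter.Eventually.of_forall fun x => abs_nonneg _) iB ?_
        filter_upwards [hp1, hp2] with x a1 a2
        simp only [estimatorOf, scl, mean_scale, var_scale]
        refine (pt_bound n hn β _ _ _ _ hβ (by positivity) (by positivity)).trans ?_
        refine mul_le_mul_of_nonneg_left (add_le_add ?_ ?_) (by positivity)
        · exact term_bound ε _ _ _ _ _ h0 h1 hv1 hv2 a1 a2
        · have := term_bound ε v.2 v.1 (sampleMean n x.2) _ _ h0 h1 hv2 hv1 a2 a1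
          rw [add_comm]
          refine this.trans (le_of_eq ?_)
          simp only [hG, hH]; ring
    _ = _ := by
        rw [integral_const_mul, integral_add ((iG.mul_prod iH).const_mul _) ((iH.mul_prod iG).const_mul _),
          integral_const_mul, integral_const_mul, integral_prod_mul, integral_prod_mul]
        ring

lemma meas_risk (n : ℕ) (φ : ℝ × ℝ → ℝ) (hφ : Measurable φ) : 
    StronglyMeasurable (fun v : ℝ × ℝ => risk n 0 v.1 v.2 φ) := by
  simp_rw [risk_eq n _ φ hφ]
  refine StronglyMeasurable.integral_prod_right ?_
  exact (((meas_est n φ hφ).comp (meas_scl n)).pow_const 2).stronglyMeasurable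

end helpers

/-- Under the product inverse-gamma prior `Π_{α,β}`, the excess Bayes risk of the
Graybill–Deal estimator over the Bayes procedure `δ_{Φ_β}` is at most `C'·β` for
all small `β`. -/
theorem gd_excess_bayes_risk_le (n : ℕ) (hn : 3 ≤ n)
    (α : ℝ) (hα : 0 < α) (hα' : α < 1 / 2) :
    ∃ C' : ℝ, 0 < C' ∧ ∃ β₀ : ℝ, 0 < β₀ ∧ ∀ β ∈ Set.Ioo (0 : ℝ) β₀,
      Integrable
        (fun v : ℝ × ℝ =>
          risk n 0 v.1 v.2 gdWeight - risk n 0 v.1 v.2 (bayesWeight n β))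
        (invGammaPrior α β) ∧
      (∫ v : ℝ × ℝ,
          (risk n 0 v.1 v.2 gdWeight - risk n 0 v.1 v.2 (bayesWeight n β))
        ∂(invGammaPrior α β)) ≤ C' * β := by
  obtain ⟨K, hK, hb⟩ := risk_diff_bound n hn (α / 2) (by linarith) (by linarith)
  set A : ℝ := (Real.Gamma (α - α/2) / Real.Gamma α) * (Real.Gamma (α + α/2) / Real.Gamma α) with hA
  set B : ℝ := (Real.Gamma (α - -(α/2)) / Real.Gamma α) * (Real.Gamma (α + -(α/2)) / Real.Gamma α) with hB
  have g0 := Real.Gamma_pos_of_pos hα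
  have hA0 : 0 < A := mul_pos (div_pos (Real.Gamma_pos_of_pos (by linarith)) g0)
    (div_pos (Real.Gamma_pos_of_pos (by linarith)) g0)
  have hB0 : 0 < B := mul_pos (div_pos (Real.Gamma_pos_of_pos (by linarith)) g0)
    (div_pos (Real.Gamma_pos_of_pos (by linarith)) g0)
  refine ⟨K * (A + B) + 1, by positivity, 1, one_pos, ?_⟩
  rintro β ⟨hβ, -⟩
  obtain ⟨i1, e1⟩ := prior_mom α β (α/2) hα (by linarith) (by linarith) hβ
  obtain ⟨i2, e2⟩ := prior_mom α β (-(α/2)) hα (by linarith) (by linarith) hβ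
  rw [neg_neg] at i2 e2
  have iB := (i1.add i2).const_mul (K * β)
  have hle : ∀ᵐ v ∂(invGammaPrior α β), 
      ‖risk n 0 v.1 v.2 gdWeight - risk n 0 v.1 v.2 (bayesWeight n β)‖ ≤
        K * β * (v.1 ^ (α/2) * v.2 ^ (-(α/2)) + v.1 ^ (-(α/2)) * v.2 ^ (α/2)) := by
    filter_upwards [prior_pos α β] with v hv
    exact hb β hβ v hv.1 hv.2
  have hint : Integrable
        (fun v : ℝ × ℝ =>
          risk n 0 v.1 v.2 gdWeight - risk n 0 v.1 v.2 (bayesWeight n β))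
        (invGammaPrior α β) := 
    iB.mono' ((meas_risk n _ meas_gd).sub (meas_risk n _ (meas_bayes n β))).aestronglyMeasurable hle
  refine ⟨hint, ?_⟩
  calc _ ≤ ∫ v : ℝ × ℝ, K * β * (v.1 ^ (α/2) * v.2 ^ (-(α/2)) + v.1 ^ (-(α/2)) * v.2 ^ (α/2)) 
        ∂(invGammaPrior α β) := by
        refine integral_mono_ae hint iB ?_
        filter_upwards [hle] with v hv
        exact (le_abs_self _).trans hv
    _ = K * β * (A + B) := by
        rw [integral_const_mul, integral_add i1 i2, e1, e2]
    _ ≤ _ := by nlinarith
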